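/- Suppose there exists B > 0 such that ‖P^n‖_{ℒ(L¹(π),L^∞(π))} ≤ B·n^{−1/2} for all n ≥ 1 (heat kernel bound (B')). Then for every given C > 0 there exists a constant Ã > 0 such that the Nash inequality ‖u‖⁶_{L²(π)} ≤ Ã · ℰ₂(u,u) · ‖u‖⁴_{L¹(π)} holds for all u satisfying ℰ₂(u,u) ≤ C·‖u‖²_{L¹(π)}. -/

import Mathlib

open Filter MeasureTheory Topology

/-- `(P^n)_{k,j}` for the balanced walk on `ℤ` with transition probabilities
`P_{k,k-1} = P_{k,k+1} = ω k`, `P_{k,k} = 1 - 2 ω k`. -/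
noncomputable def Ppow (ω : ℤ → ℝ) : ℕ → ℤ → ℤ → ℝ
  | 0, k, j => if k = j then 1 else 0
  | n + 1, k, j =>
      ω k * Ppow ω n (k - 1) j + (1 - 2 * ω k) * Ppow ω n k j + ω k * Ppow ω n (k + 1) j

/-- The operator `P` acting on functions `u : ℤ → ℝ`:
`(Pu)(k) = ω_k u(k-1) + (1 - 2ω_k) u(k) + ω_k u(k+1)`. -/
noncomputable def Pop (ω : ℤ → ℝ) (u : ℤ → ℝ) (k : ℤ) : ℝ :=
  ω k * u (k - 1) + (1 - 2 * ω k) * u k + ω k * u (k + 1)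

/-- The `L¹(π)` norm, `‖u‖_{L¹(π)} = Σ_k π_k |u(k)|` with `π_k = 1/ω_k`. -/
noncomputable def l1pi (ω : ℤ → ℝ) (u : ℤ → ℝ) : ℝ := ∑' k : ℤ, (1 / ω k) * |u k|

/-- The Dirichlet form `ℰ₂(u,u) = ⟨u, (I - P²)u⟩_π`. -/
noncomputable def dirichlet2 (ω : ℤ → ℝ) (u : ℤ → ℝ) : ℝ :=
  ∑' k : ℤ, (1 / ω k) * u k * (u k - Pop ω (Pop ω u) k)

/-- The pairing `⟨u, v⟩_π = Σ_k π_k u(k) v(k)` with `π_k = 1/ω_k`. -/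
noncomputable def innerPi (ω u v : ℤ → ℝ) : ℝ := ∑' k : ℤ, (1 / ω k) * (u k * v k)

/-- Membership in `L²(π)`. -/
def MemL2Pi (ω u : ℤ → ℝ) : Prop := Summable fun k : ℤ => (1 / ω k) * u k ^ 2

section BalancedWalk

variable {ω : ℤ → ℝ}

lemma one_le_one_div_of_balanced (hω : ∀ k : ℤ, 0 < ω k ∧ ω k ≤ 1 / 2) (k : ℤ) :
    1 ≤ 1 / ω k := by
  rw [le_div_iff₀ (hω k).1]
  linarith [(hω k).2]

lemma summable_of_summable_pi_mul (hω : ∀ k : ℤ, 0 < ω k ∧ ω k ≤ 1 / 2) {f : ℤ → ℝ}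
    (hf : Summable fun k : ℤ => (1 / ω k) * f k) : Summable f := by
  refine Summable.of_norm_bounded hf.abs fun k => ?_
  have h := one_le_one_div_of_balanced hω k
  rw [Real.norm_eq_abs, abs_mul, abs_of_nonneg (by linarith : 0 ≤ 1 / ω k)]
  nlinarith [abs_nonneg (f k)]

lemma MemL2Pi.summable_mul (hω : ∀ k : ℤ, 0 < ω k ∧ ω k ≤ 1 / 2) {u v : ℤ → ℝ}
    (hu : MemL2Pi ω u) (hv : MemL2Pi ω v) :
    Summable fun k : ℤ => (1 / ω k) * (u k * v k) := by
  refine Summable.of_norm_bounded (hu.add hv) fun k => ?_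
  have h := one_le_one_div_of_balanced hω k
  rw [Real.norm_eq_abs, abs_mul, abs_of_nonneg (by linarith : 0 ≤ 1 / ω k), ← mul_add]
  refine mul_le_mul_of_nonneg_left ?_ (by linarith)
  rw [abs_le]
  constructor <;> nlinarith [sq_nonneg (u k + v k), sq_nonneg (u k - v k)]

lemma MemL2Pi.comp_add (hω : ∀ k : ℤ, 0 < ω k ∧ ω k ≤ 1 / 2) {u : ℤ → ℝ}
    (hu : MemL2Pi ω u) (m : ℤ) : Summable fun k : ℤ => u (k + m) ^ 2 :=
  (Equiv.addRight m).summable_iff.mpr (summable_of_summable_pi_mul hω hu)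

lemma hasSum_pi_mul_Pop (hω : ∀ k : ℤ, 0 < ω k ∧ ω k ≤ 1 / 2) {f : ℤ → ℝ}
    (hf : Summable fun k : ℤ => (1 / ω k) * f k) :
    HasSum (fun k : ℤ => (1 / ω k) * Pop ω f k) (∑' k : ℤ, (1 / ω k) * f k) := by
  have hs := (summable_of_summable_pi_mul hω hf).hasSum
  have hl : HasSum (fun k : ℤ => f (k - 1)) (∑' k, f k) := (Equiv.subRight 1).hasSum_iff.mpr hs
  have hr : HasSum (fun k : ℤ => f (k + 1)) (∑' k, f k) := (Equiv.addRight 1).hasSum_iff.mpr hs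
  convert (hl.add (hf.hasSum.sub (hs.mul_left 2))).add hr using 1
  · funext k
    have := (hω k).1.ne'
    simp only [Pop]
    field_simp
  · ring

lemma Pop_sq_le (hω : ∀ k : ℤ, 0 < ω k ∧ ω k ≤ 1 / 2) (u : ℤ → ℝ) (k : ℤ) :
    Pop ω u k ^ 2 ≤ Pop ω (fun j => u j ^ 2) k := by
  obtain ⟨h0, h1⟩ := hω k
  have ha : 0 ≤ ω k * (1 - 2 * ω k) := mul_nonneg h0.le (by linarith)
  simp only [Pop]
  nlinarith [mul_nonneg ha (sq_nonneg (u (k - 1) - u k)),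
    mul_nonneg ha (sq_nonneg (u (k + 1) - u k)),
    mul_nonneg (sq_nonneg (ω k)) (sq_nonneg (u (k + 1) - u (k - 1)))]

lemma MemL2Pi.pop (hω : ∀ k : ℤ, 0 < ω k ∧ ω k ≤ 1 / 2) {u : ℤ → ℝ} (hu : MemL2Pi ω u) :
    MemL2Pi ω (Pop ω u) := by
  refine Summable.of_nonneg_of_le (fun k => ?_) (fun k => ?_) (hasSum_pi_mul_Pop hω hu).summable
  · have := (hω k).1
    positivity
  · exact mul_le_mul_of_nonneg_left (Pop_sq_le hω u k)
      (by linarith [one_le_one_div_of_balanced hω k])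

lemma MemL2Pi.iterate_pop (hω : ∀ k : ℤ, 0 < ω k ∧ ω k ≤ 1 / 2) {u : ℤ → ℝ}
    (hu : MemL2Pi ω u) (n : ℕ) : MemL2Pi ω ((Pop ω)^[n] u) := by
  induction n with
  | zero => exact hu
  | succ n ih =>
    rw [Function.iterate_succ_apply']
    exact ih.pop hω

lemma innerPi_self_nonneg (hω : ∀ k : ℤ, 0 < ω k ∧ ω k ≤ 1 / 2) (u : ℤ → ℝ) :
    0 ≤ innerPi ω u u :=
  tsum_nonneg fun k => mul_nonneg (by linarith [one_le_one_div_of_balanced hω k])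
    (mul_self_nonneg _)

lemma two_mul_innerPi_le (hω : ∀ k : ℤ, 0 < ω k ∧ ω k ≤ 1 / 2) {u v : ℤ → ℝ}
    (hu : MemL2Pi ω u) (hv : MemL2Pi ω v) :
    2 * innerPi ω u v ≤ innerPi ω u u + innerPi ω v v := by
  have huu := hu.summable_mul hω hu
  have hvv := hv.summable_mul hω hv
  simp only [innerPi]
  rw [← huu.tsum_add hvv, ← tsum_mul_left]
  refine ((hu.summable_mul hω hv).mul_left 2).tsum_le_tsum (fun k => ?_) (huu.add hvv)
  have h := one_le_one_div_of_balanced hω k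
  nlinarith [mul_nonneg (by linarith : 0 ≤ 1 / ω k) (sq_nonneg (u k - v k))]

/-- `P` is a contraction of `L²(π)`. -/
lemma innerPi_Pop_self_le (hω : ∀ k : ℤ, 0 < ω k ∧ ω k ≤ 1 / 2) {u : ℤ → ℝ}
    (hu : MemL2Pi ω u) : innerPi ω (Pop ω u) (Pop ω u) ≤ innerPi ω u u := by
  have h := hasSum_pi_mul_Pop hω hu
  simp only [innerPi, ← pow_two]
  rw [← h.tsum_eq]
  exact (hu.pop hω).tsum_le_tsum (fun k => mul_le_mul_of_nonneg_left (Pop_sq_le hω u k)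
    (by linarith [one_le_one_div_of_balanced hω k])) h.summable

/-- `P` is symmetric on `L²(π)`. -/
lemma innerPi_Pop_left (hω : ∀ k : ℤ, 0 < ω k ∧ ω k ≤ 1 / 2) {u v : ℤ → ℝ}
    (hu : MemL2Pi ω u) (hv : MemL2Pi ω v) :
    innerPi ω (Pop ω u) v = innerPi ω u (Pop ω v) := by
  have summable_shift : ∀ {f g : ℤ → ℝ}, MemL2Pi ω f → MemL2Pi ω g →
      Summable fun k : ℤ => f k * g (k + 1) := fun {f g} hf hg => by
    refine Summable.of_norm_bounded
      ((summable_of_summable_pi_mul hω hf).add (hg.comp_add hω 1)) fun k => ?_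
    rw [Real.norm_eq_abs, abs_le]
    constructor <;> nlinarith [sq_nonneg (f k + g (k + 1)), sq_nonneg (f k - g (k + 1))]
  have shift_back : ∀ {f g : ℤ → ℝ} {a : ℝ}, HasSum (fun k : ℤ => f k * g (k + 1)) a →
      HasSum (fun k : ℤ => f (k - 1) * g k) a := fun {f g a} h => by
    simpa [Function.comp_def] using (Equiv.subRight (1 : ℤ)).hasSum_iff.mpr h
  have huv := (summable_shift hu hv).hasSum
  have hvu := (summable_shift hv hu).hasSum
  have hd := (hu.summable_mul hω hv).hasSum
  have hs := (summable_of_summable_pi_mul hω (hu.summable_mul hω hv)).hasSum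
  have hdiag := hd.sub (hs.mul_left 2)
  have hleft := ((shift_back huv).add hvu).add hdiag
  have hright := (huv.add (shift_back hvu)).add hdiag
  refine (Eq.trans ?_ hleft.tsum_eq).trans (Eq.trans hright.tsum_eq.symm ?_)
  all_goals
    refine tsum_congr fun k => ?_
    have := (hω k).1.ne'
    simp only [Pop]
    field_simp
    ring

lemma dirichlet2_eq (hω : ∀ k : ℤ, 0 < ω k ∧ ω k ≤ 1 / 2) {u : ℤ → ℝ} (hu : MemL2Pi ω u) :
    dirichlet2 ω u = innerPi ω u u - innerPi ω (Pop ω u) (Pop ω u) := by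
  have hP := hu.pop hω
  rw [innerPi_Pop_left hω hu hP, innerPi, innerPi,
    ← (hu.summable_mul hω hu).tsum_sub (hu.summable_mul hω (hP.pop hω)), dirichlet2]
  exact tsum_congr fun k => by ring

/-- The energy `ℰ₂` does not increase under `P`. -/
lemma dirichlet2_Pop_le (hω : ∀ k : ℤ, 0 < ω k ∧ ω k ≤ 1 / 2) {u : ℤ → ℝ}
    (hu : MemL2Pi ω u) : dirichlet2 ω (Pop ω u) ≤ dirichlet2 ω u := by
  have hP := hu.pop hω
  have h := two_mul_innerPi_le hω hu (hP.pop hω)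
  rw [← innerPi_Pop_left hω hu hP] at h
  rw [dirichlet2_eq hω hu, dirichlet2_eq hω hP]
  linarith

lemma dirichlet2_iterate_le (hω : ∀ k : ℤ, 0 < ω k ∧ ω k ≤ 1 / 2) {u : ℤ → ℝ}
    (hu : MemL2Pi ω u) (n : ℕ) : dirichlet2 ω ((Pop ω)^[n] u) ≤ dirichlet2 ω u := by
  induction n with
  | zero => exact le_rfl
  | succ n ih =>
    rw [Function.iterate_succ_apply']
    exact (dirichlet2_Pop_le hω (hu.iterate_pop hω n)).trans ih

lemma innerPi_self_le_add_iterate (hω : ∀ k : ℤ, 0 < ω k ∧ ω k ≤ 1 / 2) {u : ℤ → ℝ}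
    (hu : MemL2Pi ω u) (n : ℕ) :
    innerPi ω u u ≤ n * dirichlet2 ω u + innerPi ω ((Pop ω)^[n] u) ((Pop ω)^[n] u) := by
  induction n with
  | zero => simp
  | succ n ih =>
    have h := dirichlet2_iterate_le hω hu n
    rw [dirichlet2_eq hω (hu.iterate_pop hω n)] at h
    rw [Function.iterate_succ_apply']
    push_cast
    linarith

lemma innerPi_iterate_left (hω : ∀ k : ℤ, 0 < ω k ∧ ω k ≤ 1 / 2) {u v : ℤ → ℝ}
    (hu : MemL2Pi ω u) (hv : MemL2Pi ω v) (n : ℕ) :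
    innerPi ω ((Pop ω)^[n] u) v = innerPi ω u ((Pop ω)^[n] v) := by
  induction n generalizing v with
  | zero => rfl
  | succ n ih =>
    rw [Function.iterate_succ_apply', innerPi_Pop_left hω (hu.iterate_pop hω n) hv,
      ih (hv.pop hω), Function.iterate_succ_apply]

lemma innerPi_le_mul_l1pi (hω : ∀ k : ℤ, 0 < ω k ∧ ω k ≤ 1 / 2) {u v : ℤ → ℝ}
    (hu : MemL2Pi ω u) (hv : MemL2Pi ω v) (hu1 : Summable fun k : ℤ => (1 / ω k) * |u k|)
    {M : ℝ} (hM : ∀ k, |v k| ≤ M) : innerPi ω u v ≤ M * l1pi ω u := by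
  rw [innerPi, l1pi, ← tsum_mul_left]
  refine (hu.summable_mul hω hv).tsum_le_tsum (fun k => ?_) (hu1.mul_left M)
  have h : u k * v k ≤ |u k| * M :=
    (le_abs_self _).trans ((abs_mul _ _).trans_le
      (mul_le_mul_of_nonneg_left (hM k) (abs_nonneg _)))
  calc 1 / ω k * (u k * v k) ≤ 1 / ω k * (|u k| * M) :=
        mul_le_mul_of_nonneg_left h (by linarith [one_le_one_div_of_balanced hω k])
    _ = M * (1 / ω k * |u k|) := by ring

lemma innerPi_self_le_of_heat_kernel_bound (hω : ∀ k : ℤ, 0 < ω k ∧ ω k ≤ 1 / 2)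
    {B : ℝ} (hB : 0 < B) {u : ℤ → ℝ} (hu : MemL2Pi ω u)
    (hu1 : Summable fun k : ℤ => (1 / ω k) * |u k|)
    (hheat : ∀ n : ℕ, 1 ≤ n → ∀ k : ℤ,
      |(Pop ω)^[n] u k| ≤ B * (n : ℝ) ^ (-(1:ℝ)/2) * l1pi ω u)
    {n : ℕ} (hn : 1 ≤ n) :
    innerPi ω u u ≤ n * dirichlet2 ω u + B * (n : ℝ) ^ (-(1:ℝ)/2) * l1pi ω u ^ 2 := by
  refine (innerPi_self_le_add_iterate hω hu n).trans (add_le_add le_rfl ?_)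
  rw [innerPi_iterate_left hω hu (hu.iterate_pop hω n), ← Function.iterate_add_apply]
  refine (innerPi_le_mul_l1pi hω hu (hu.iterate_pop hω _) hu1 (hheat (n + n) (by omega))).trans ?_
  have hn0 : (0 : ℝ) < n := by exact_mod_cast hn
  have hpow : ((n + n : ℕ) : ℝ) ^ (-(1:ℝ)/2) ≤ (n : ℝ) ^ (-(1:ℝ)/2) :=
    Real.rpow_le_rpow_of_nonpos hn0 (by push_cast; linarith) (by norm_num)
  calc B * ((n + n : ℕ) : ℝ) ^ (-(1:ℝ)/2) * l1pi ω u * l1pi ω u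
      = B * ((n + n : ℕ) : ℝ) ^ (-(1:ℝ)/2) * l1pi ω u ^ 2 := by ring
    _ ≤ B * (n : ℝ) ^ (-(1:ℝ)/2) * l1pi ω u ^ 2 := by gcongr

end BalancedWalk

/-- Optimizing `N ≤ n E + B n^{-1/2} S` over the integers `n ≥ 1` when `E ≤ C S`. -/
lemma cube_le_of_forall_le_add_rpow {N E S B C : ℝ} (hN : 0 ≤ N) (hE : 0 ≤ E)
    (hB : 0 < B) (hC : 0 < C) (hES : E ≤ C * S)
    (h : ∀ n : ℕ, 1 ≤ n → N ≤ n * E + B * (n : ℝ) ^ (-(1:ℝ)/2) * S) :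
    N ^ 3 ≤ (1 + C ^ ((2:ℝ)/3) + B) ^ 3 * E * S ^ 2 := by
  rcases hE.eq_or_lt with rfl | hE
  · have hlim : Tendsto (fun n : ℕ => (n : ℝ) * 0 + B * (n : ℝ) ^ (-(1:ℝ)/2) * S) atTop (𝓝 0) := by
      have h0 := (tendsto_rpow_neg_atTop (by norm_num : (0:ℝ) < 1 / 2)).comp
        tendsto_natCast_atTop_atTop
      simpa [Function.comp_def, neg_div] using (h0.const_mul B).mul_const S
    have hN0 : N ≤ 0 := ge_of_tendsto hlim ((eventually_ge_atTop 1).mono h)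
    simp [le_antisymm hN0 hN]
  have hS : 0 < S := pos_of_mul_pos_right (hE.trans_le hES) hC.le
  set t : ℝ := (S / E) ^ ((1:ℝ)/3) with ht
  have ht0 : 0 < t := by positivity
  have ht3 : t ^ 3 = S / E := by
    rw [ht, ← Real.rpow_natCast, ← Real.rpow_mul (by positivity)]
    norm_num
  have hS3 : S = t ^ 3 * E := by rw [ht3]; field_simp
  set c : ℝ := C ^ ((1:ℝ)/3) with hc
  have hc0 : 0 < c := by positivity
  have hc3 : c ^ 3 = C := by
    rw [hc, ← Real.rpow_natCast, ← Real.rpow_mul hC.le]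
    norm_num
  have hc2 : C ^ ((2:ℝ)/3) = c ^ 2 := by
    rw [hc, ← Real.rpow_natCast, ← Real.rpow_mul hC.le]
    norm_num
  have hct : 1 ≤ c * t := by
    have h1 : E ≤ (c * t) ^ 3 * E := by
      calc E ≤ C * S := hES
        _ = (c * t) ^ 3 * E := by rw [← hc3, hS3]; ring
    have h3 : 1 ^ 3 ≤ (c * t) ^ 3 := by
      rw [one_pow]
      exact le_of_mul_le_mul_right (by linarith) hE
    exact le_of_pow_le_pow_left₀ (by norm_num) (by positivity) h3
  have hceil : 1 ≤ ⌈t ^ 2⌉₊ := Nat.one_le_ceil_iff.mpr (by positivity)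
  have hle : t ^ 2 ≤ (⌈t ^ 2⌉₊ : ℝ) := Nat.le_ceil _
  have hlt : (⌈t ^ 2⌉₊ : ℝ) ≤ (1 + c ^ 2) * t ^ 2 := by
    have := (Nat.ceil_lt_add_one (by positivity : 0 ≤ t ^ 2)).le
    nlinarith
  have hpow : (⌈t ^ 2⌉₊ : ℝ) ^ (-(1:ℝ)/2) ≤ t⁻¹ := by
    refine (Real.rpow_le_rpow_of_nonpos (by positivity) hle (by norm_num)).trans_eq ?_
    rw [← Real.rpow_natCast, ← Real.rpow_mul ht0.le, ← Real.rpow_neg_one]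
    norm_num
  have hfin : N ≤ (1 + c ^ 2 + B) * (t ^ 2 * E) := by
    calc N ≤ ⌈t ^ 2⌉₊ * E + B * (⌈t ^ 2⌉₊ : ℝ) ^ (-(1:ℝ)/2) * S := h _ hceil
      _ ≤ ((1 + c ^ 2) * t ^ 2) * E + B * t⁻¹ * S := by gcongr
      _ = (1 + c ^ 2 + B) * (t ^ 2 * E) := by
        rw [hS3]
        field_simp
  calc N ^ 3 ≤ ((1 + c ^ 2 + B) * (t ^ 2 * E)) ^ 3 := by gcongr
    _ = (1 + C ^ ((2:ℝ)/3) + B) ^ 3 * E * S ^ 2 := by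
      rw [hc2, hS3]
      ring

/-- **Claim in Lemma 6 (improved Nash inequality).**  Suppose the heat-kernel bound (B')
holds: there is `B > 0` with `‖P^n‖_{ℒ(L¹(π),L^∞(π))} ≤ B n^{-1/2}` for all `n ≥ 1`.
Then for every `C > 0` there is `Ã > 0` such that
`‖u‖⁶_{L²(π)} ≤ Ã ℰ₂(u,u) ‖u‖⁴_{L¹(π)}` whenever `ℰ₂(u,u) ≤ C ‖u‖²_{L¹(π)}`. -/
theorem nash_inequality_from_heat_kernel_bound
    (ω : ℤ → ℝ) (hω : ∀ k : ℤ, 0 < ω k ∧ ω k ≤ 1 / 2)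
    (B : ℝ) (hB : 0 < B)
    -- (B'): `‖P^n u‖_{L^∞(π)} ≤ B n^{-1/2} ‖u‖_{L¹(π)}` for `n ≥ 1`
    (hBprime : ∀ n : ℕ, 1 ≤ n → ∀ u : ℤ → ℝ,
      Summable (fun k : ℤ => (1 / ω k) * |u k|) →
      ∀ k : ℤ, |(Pop ω)^[n] u k| ≤ B * (n : ℝ) ^ (-(1:ℝ)/2) * l1pi ω u) :
    ∀ C : ℝ, 0 < C → ∃ A : ℝ, 0 < A ∧ ∀ u : ℤ → ℝ,
      Summable (fun k : ℤ => (1 / ω k) * |u k|) →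
      Summable (fun k : ℤ => (1 / ω k) * u k ^ 2) →
      dirichlet2 ω u ≤ C * l1pi ω u ^ 2 →
      (∑' k : ℤ, (1 / ω k) * u k ^ 2) ^ 3 ≤ A * dirichlet2 ω u * l1pi ω u ^ 4 := by
  intro C hC
  refine ⟨(1 + C ^ ((2:ℝ)/3) + B) ^ 3, by positivity, fun u hu1 hu2 hE => ?_⟩
  have hu : MemL2Pi ω u := hu2
  have hE0 : 0 ≤ dirichlet2 ω u := by
    rw [dirichlet2_eq hω hu]
    linarith [innerPi_Pop_self_le hω hu]
  have hN : ∑' k : ℤ, (1 / ω k) * u k ^ 2 = innerPi ω u u := by simp only [innerPi, pow_two]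
  rw [hN, show l1pi ω u ^ 4 = (l1pi ω u ^ 2) ^ 2 by ring]
  exact cube_le_of_forall_le_add_rpow (innerPi_self_nonneg hω u) hE0 hB hC hE
    fun n hn => innerPi_self_le_of_heat_kernel_bound hω hB hu hu1
      (fun n hn => hBprime n hn u hu1) hn
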